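/- Let x₁, …, x_N and y₁, …, y_N be points of ℝ^n, let R be an S × n random matrix with independent entries each distributed according to the standard Gaussian measure on ℝ, and define f : ℝ^n → ℝ^S by f(x) = (1/√S) R x. Let 0 < ε < 1 and let T ≥ 1 be a real number with S (ε²/2 − ε³/3) ≥ 4 log T. Then for each fixed pair of indices i, j with x_i ≠ y_j, P( (1 − ε) ‖x_i − y_j‖₂² ≤ ‖f(x_i) − f(y_j)‖₂² ≤ (1 + ε) ‖x_i − y_j‖₂² ) ≥ 1 − 2/T². -/

import Mathlib

open MeasureTheory ProbabilityTheory

/-- The third order Taylor polynomial of `log (1 + x)` at `0` is an upper bound. -/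
lemma log_one_add_le_taylor_three {x : ℝ} (hx : -1 < x) :
    Real.log (1 + x) ≤ x - x ^ 2 / 2 + x ^ 3 / 3 := by
  set g : ℝ → ℝ := fun y => y - y ^ 2 / 2 + y ^ 3 / 3 - Real.log (1 + y) with hg
  have hderiv (y : ℝ) (hy : -1 < y) : HasDerivAt g (y ^ 3 / (1 + y)) y := by
    have h0 : 1 + y ≠ 0 := by linarith
    have h := ((((hasDerivAt_id y).sub (((hasDerivAt_id y).pow 2).div_const 2)).add
      (((hasDerivAt_id y).pow 3).div_const 3)).sub (((hasDerivAt_id y).const_add 1).log h0))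
    refine h.congr_deriv ?_
    simp only [id]
    field_simp
    push_cast
    ring
  have hzero : g 0 = 0 := by simp [hg]
  suffices 0 ≤ g x by simp only [hg] at this; linarith
  rw [← hzero]
  rcases le_total 0 x with h | h
  · refine monotoneOn_of_hasDerivWithinAt_nonneg (convex_Icc 0 x)
      (fun y hy => (hderiv y (by linarith [hy.1])).continuousAt.continuousWithinAt)
      (fun y hy => (hderiv y ?_).hasDerivWithinAt) (fun y hy => ?_)
      (Set.left_mem_Icc.2 h) (Set.right_mem_Icc.2 h) h
    · rw [interior_Icc] at hy; linarith [hy.1]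
    · rw [interior_Icc] at hy
      have := hy.1
      positivity
  · refine antitoneOn_of_hasDerivWithinAt_nonpos (convex_Icc x 0)
      (fun y hy => (hderiv y (by linarith [hy.1])).continuousAt.continuousWithinAt)
      (fun y hy => (hderiv y ?_).hasDerivWithinAt) (fun y hy => ?_)
      (Set.left_mem_Icc.2 h) (Set.right_mem_Icc.2 h) h
    · rw [interior_Icc] at hy; linarith [hy.1]
    · rw [interior_Icc] at hy
      exact div_nonpos_of_nonpos_of_nonneg (Odd.pow_nonpos (by decide) hy.2.le)
        (by linarith [hy.1])

/-- A linear combination of independent standard Gaussians is Gaussian. -/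
lemma map_pi_gaussianReal_sum_mul {n : ℕ} (u : EuclideanSpace ℝ (Fin n)) :
    (Measure.pi fun _ : Fin n => gaussianReal 0 1).map (fun r => ∑ l, r l * u l) =
      gaussianReal 0 (‖u‖ ^ 2).toNNReal := by
  have hmeas : Measurable fun r : Fin n → ℝ => ∑ l, r l * u l := by fun_prop
  have : IsProbabilityMeasure
      ((Measure.pi fun _ : Fin n => gaussianReal 0 1).map (fun r => ∑ l, r l * u l)) :=
    Measure.isProbabilityMeasure_map hmeas.aemeasurable
  apply Measure.ext_of_charFun
  ext t
  rw [charFun_apply_real, integral_map hmeas.aemeasurable (by fun_prop)]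
  have hprod (r : Fin n → ℝ) :
      Complex.exp (t * ((∑ l, r l * u l : ℝ) : ℂ) * Complex.I) =
        ∏ l, Complex.exp (((t * u l : ℝ) : ℂ) * (r l : ℂ) * Complex.I) := by
    rw [← Complex.exp_sum]
    congr 1
    push_cast
    rw [Finset.mul_sum, Finset.sum_mul]
    exact Finset.sum_congr rfl fun l _ => by ring
  simp_rw [hprod]
  rw [integral_fintype_prod_eq_prod
    (f := fun l (x : ℝ) => Complex.exp (((t * u l : ℝ) : ℂ) * (x : ℂ) * Complex.I))]
  simp_rw [← charFun_apply_real, charFun_gaussianReal, ← Complex.exp_sum]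
  congr 1
  rw [Real.coe_toNNReal _ (by positivity), EuclideanSpace.real_norm_sq_eq]
  push_cast
  simp only [mul_zero, zero_mul, zero_sub, Finset.sum_neg_distrib, neg_inj]
  rw [Finset.sum_mul, Finset.sum_div]
  exact Finset.sum_congr rfl fun l _ => by ring

lemma gaussianPDFReal_smul_exp_mul_sq {v : NNReal} (hv : v ≠ 0) (t x : ℝ) :
    gaussianPDFReal 0 v x • Real.exp (t * x ^ 2) =
      (√(2 * Real.pi * v))⁻¹ * Real.exp (-(1 / (2 * v) - t) * x ^ 2) := by
  have : (v : ℝ) ≠ 0 := by exact_mod_cast hv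
  rw [gaussianPDFReal, smul_eq_mul, mul_assoc, ← Real.exp_add]
  congr 2
  field_simp
  ring

/-- Exponential integrability of the square of a centered Gaussian. -/
lemma integrable_exp_mul_sq_gaussianReal {v : NNReal} (hv : v ≠ 0) {t : ℝ}
    (ht : 2 * t * v < 1) :
    Integrable (fun x : ℝ => Real.exp (t * x ^ 2)) (gaussianReal 0 v) := by
  have hv' : (0 : ℝ) < v := by exact_mod_cast pos_iff_ne_zero.2 hv
  have hb : 0 < 1 / (2 * (v : ℝ)) - t := by
    rw [sub_pos, lt_div_iff₀ (by positivity)]; linarith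
  rw [gaussianReal_of_var_ne_zero _ hv, integrable_withDensity_iff_integrable_smul'
    (measurable_gaussianPDF _ _) (ae_of_all _ fun _ => gaussianPDF_lt_top)]
  simp_rw [toReal_gaussianPDF, gaussianPDFReal_smul_exp_mul_sq hv]
  exact (integrable_exp_neg_mul_sq hb).const_mul _

/-- The moment generating function of the square of a centered Gaussian. -/
lemma integral_exp_mul_sq_gaussianReal {v : NNReal} (hv : v ≠ 0) {t : ℝ}
    (ht : 2 * t * v < 1) :
    ∫ x : ℝ, Real.exp (t * x ^ 2) ∂(gaussianReal 0 v) = √((1 - 2 * t * v)⁻¹) := by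
  have hv' : (0 : ℝ) < v := by exact_mod_cast pos_iff_ne_zero.2 hv
  have h1 : 1 - 2 * t * v ≠ 0 := by linarith
  have hb : 1 / (2 * (v : ℝ)) - t = (1 - 2 * t * v) / (2 * v) := by field_simp
  rw [integral_gaussianReal_eq_integral_smul hv]
  simp_rw [gaussianPDFReal_smul_exp_mul_sq hv]
  rw [integral_const_mul, integral_gaussian, ← Real.sqrt_inv, ← Real.sqrt_mul (by positivity), hb]
  congr 1
  field_simp

section SumSquares

variable {ι : Type*} [Fintype ι] {v : NNReal}

lemma integrable_exp_mul_sum_sq_pi_gaussianReal (hv : v ≠ 0) {t : ℝ} (ht : 2 * t * v < 1) :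
    Integrable (fun z : ι → ℝ => Real.exp (t * ∑ k, z k ^ 2))
      (Measure.pi fun _ : ι => gaussianReal 0 v) := by
  simp_rw [Finset.mul_sum, Real.exp_sum]
  exact Integrable.fintype_prod fun _ => integrable_exp_mul_sq_gaussianReal hv ht

lemma mgf_sum_sq_pi_gaussianReal (hv : v ≠ 0) {t : ℝ} (ht : 2 * t * v < 1) :
    mgf (fun z : ι → ℝ => ∑ k, z k ^ 2) (Measure.pi fun _ : ι => gaussianReal 0 v) t =
      √((1 - 2 * t * v)⁻¹) ^ Fintype.card ι := by
  rw [mgf]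
  simp_rw [Finset.mul_sum, Real.exp_sum]
  rw [integral_fintype_prod_eq_pow (fun x : ℝ => Real.exp (t * x ^ 2)),
    integral_exp_mul_sq_gaussianReal hv ht]

lemma one_sub_two_mul_div_mul_one_add (hv : v ≠ 0) {δ : ℝ} (hδ : -1 < δ) :
    1 - 2 * (δ / (2 * v * (1 + δ))) * v = (1 + δ)⁻¹ := by
  have hv' : (v : ℝ) ≠ 0 := by exact_mod_cast hv
  have hδ' : 1 + δ ≠ 0 := by linarith
  field_simp
  ring

lemma two_mul_div_mul_one_add_lt_one (hv : v ≠ 0) {δ : ℝ} (hδ : -1 < δ) :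
    2 * (δ / (2 * v * (1 + δ))) * v < 1 := by
  rw [← sub_pos, one_sub_two_mul_div_mul_one_add hv hδ, inv_pos]
  linarith

/-- The optimized Chernoff exponent for a sum of squares of independent centered Gaussians. -/
lemma exp_mul_mgf_sum_sq_pi_gaussianReal_le (hv : v ≠ 0) {δ : ℝ} (hδ : -1 < δ) :
    Real.exp (-(δ / (2 * v * (1 + δ))) * (Fintype.card ι * (1 + δ) * v)) *
        mgf (fun z : ι → ℝ => ∑ k, z k ^ 2) (Measure.pi fun _ : ι => gaussianReal 0 v)
          (δ / (2 * v * (1 + δ))) ≤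
      Real.exp (-(Fintype.card ι / 2 * (δ ^ 2 / 2 - δ ^ 3 / 3))) := by
  have hv' : (0 : ℝ) < v := by exact_mod_cast pos_iff_ne_zero.2 hv
  have hδ' : 0 < 1 + δ := by linarith
  rw [mgf_sum_sq_pi_gaussianReal hv (two_mul_div_mul_one_add_lt_one hv hδ),
    one_sub_two_mul_div_mul_one_add hv hδ, inv_inv, ← Real.exp_log hδ', ← Real.exp_half,
    ← Real.exp_nat_mul, Real.exp_log hδ', ← Real.exp_add, Real.exp_le_exp]
  have h := mul_le_mul_of_nonneg_left (log_one_add_le_taylor_three hδ)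
    (Nat.cast_nonneg (α := ℝ) (Fintype.card ι))
  have he : -(δ / (2 * v * (1 + δ))) * (Fintype.card ι * (1 + δ) * v) =
      -(Fintype.card ι * δ / 2) := by field_simp
  rw [he]
  linarith

/-- Upper tail of a sum of squares of independent centered Gaussians. -/
lemma measureReal_sum_sq_ge_le (hv : v ≠ 0) {ε : ℝ} (hε : 0 ≤ ε) :
    (Measure.pi fun _ : ι => gaussianReal 0 v).real
        {z | Fintype.card ι * (1 + ε) * v ≤ ∑ k, z k ^ 2} ≤
      Real.exp (-(Fintype.card ι / 2 * (ε ^ 2 / 2 - ε ^ 3 / 3))) :=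
  (measure_ge_le_exp_mul_mgf _ (by positivity)
    (integrable_exp_mul_sum_sq_pi_gaussianReal hv
      (two_mul_div_mul_one_add_lt_one hv (by linarith)))).trans
    (exp_mul_mgf_sum_sq_pi_gaussianReal_le hv (by linarith))

/-- Lower tail of a sum of squares of independent centered Gaussians. -/
lemma measureReal_sum_sq_le_le (hv : v ≠ 0) {ε : ℝ} (hε₀ : 0 ≤ ε) (hε₁ : ε < 1) :
    (Measure.pi fun _ : ι => gaussianReal 0 v).real
        {z | ∑ k, z k ^ 2 ≤ Fintype.card ι * (1 - ε) * v} ≤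
      Real.exp (-(Fintype.card ι / 2 * (ε ^ 2 / 2 - ε ^ 3 / 3))) := by
  have hδ : -1 < -ε := by linarith
  have ht : -ε / (2 * v * (1 + -ε)) ≤ 0 :=
    div_nonpos_of_nonpos_of_nonneg (by linarith) (mul_nonneg (by positivity) (by linarith))
  have h := (measure_le_le_exp_mul_mgf (Fintype.card ι * (1 + -ε) * v) ht
    (integrable_exp_mul_sum_sq_pi_gaussianReal (ι := ι) hv
      (two_mul_div_mul_one_add_lt_one hv hδ))).trans
    (exp_mul_mgf_sum_sq_pi_gaussianReal_le hv hδ)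
  rw [← sub_eq_add_neg] at h
  refine h.trans (Real.exp_le_exp.2 (neg_le_neg ?_))
  have : 0 ≤ ε ^ 3 := by positivity
  refine mul_le_mul_of_nonneg_left ?_ (by positivity)
  rw [neg_sq, Odd.neg_pow (by decide)]
  linarith

lemma measurableSet_sum_sq_mem_Icc (a b : ℝ) :
    MeasurableSet {z : ι → ℝ | a ≤ ∑ k, z k ^ 2 ∧ ∑ k, z k ^ 2 ≤ b} := by
  have h : Measurable fun z : ι → ℝ => ∑ k, z k ^ 2 := by fun_prop
  exact (measurableSet_le measurable_const h).inter (measurableSet_le h measurable_const)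

/-- Two-sided concentration of a sum of squares of independent centered Gaussians. -/
lemma one_sub_two_mul_exp_le_measureReal_sum_sq (hv : v ≠ 0) {ε : ℝ} (hε₀ : 0 ≤ ε)
    (hε₁ : ε < 1) :
    1 - 2 * Real.exp (-(Fintype.card ι / 2 * (ε ^ 2 / 2 - ε ^ 3 / 3))) ≤
      (Measure.pi fun _ : ι => gaussianReal 0 v).real
        {z | Fintype.card ι * (1 - ε) * v ≤ ∑ k, z k ^ 2 ∧
          ∑ k, z k ^ 2 ≤ Fintype.card ι * (1 + ε) * v} := by
  set μ := Measure.pi fun _ : ι => gaussianReal 0 v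
  have hsub : {z : ι → ℝ | Fintype.card ι * (1 - ε) * v ≤ ∑ k, z k ^ 2 ∧
      ∑ k, z k ^ 2 ≤ Fintype.card ι * (1 + ε) * v}ᶜ ⊆
      {z | Fintype.card ι * (1 + ε) * v ≤ ∑ k, z k ^ 2} ∪
        {z | ∑ k, z k ^ 2 ≤ Fintype.card ι * (1 - ε) * v} := by
    intro z hz
    by_contra hcon
    rw [Set.mem_union, not_or] at hcon
    exact hz ⟨(not_le.1 hcon.2).le, (not_le.1 hcon.1).le⟩
  have h := (measureReal_mono (μ := μ) hsub).trans (measureReal_union_le _ _)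
  rw [probReal_compl_eq_one_sub (measurableSet_sum_sq_mem_Icc _ _)] at h
  linarith [measureReal_sum_sq_ge_le (ι := ι) hv hε₀, measureReal_sum_sq_le_le (ι := ι) hv hε₀ hε₁]

end SumSquares

/-- The image of a fixed vector under a standard Gaussian matrix has independent
centered Gaussian entries. -/
lemma measurePreserving_gaussian_mulVec (S : ℕ) {n : ℕ} (u : EuclideanSpace ℝ (Fin n)) :
    MeasurePreserving (fun (r : Fin S → Fin n → ℝ) k => ∑ l, r k l * u l)
      (Measure.pi fun _ : Fin S => Measure.pi fun _ : Fin n => gaussianReal 0 1)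
      (Measure.pi fun _ : Fin S => gaussianReal 0 (‖u‖ ^ 2).toNNReal) :=
  measurePreserving_pi _ _ fun _ => ⟨by fun_prop, map_pi_gaussianReal_sum_mul u⟩

/-- Pairwise distance preservation: with `f(x) = (1/√S) R x` for an `S × n`
random matrix `R` with i.i.d. standard Gaussian entries, for any fixed pair of
points `x i ≠ y j`, the squared distance `‖f(x i) − f(y j)‖²` lies within a
`(1 ± ε)` factor of `‖x i − y j‖²` with probability at least `1 − 2/T²`. -/
theorem jl_pairwise_distance_preservation
    {Ω : Type*} [MeasureSpace Ω] [IsProbabilityMeasure (ℙ : Measure Ω)]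
    (S n N : ℕ) (R : Ω → Fin S → Fin n → ℝ) (hRm : Measurable R)
    (hRdist : Measure.map R ℙ =
      Measure.pi fun _ : Fin S => Measure.pi fun _ : Fin n => gaussianReal 0 1)
    (x y : Fin N → EuclideanSpace ℝ (Fin n))
    (f : Ω → EuclideanSpace ℝ (Fin n) → Fin S → ℝ)
    (hf : ∀ ω z k, f ω z k = (1 / Real.sqrt S) * ∑ l : Fin n, R ω k l * z l)
    (ε : ℝ) (hε₀ : 0 < ε) (hε₁ : ε < 1)
    (T : ℝ) (hT : 1 ≤ T)
    (hS : 4 * Real.log T ≤ S * (ε ^ 2 / 2 - ε ^ 3 / 3))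
    (i j : Fin N) (hxy : x i ≠ y j) :
    1 - 2 / T ^ 2 ≤
      (ℙ {ω | (1 - ε) * ‖x i - y j‖ ^ 2 ≤ ∑ k : Fin S, (f ω (x i) k - f ω (y j) k) ^ 2 ∧
              ∑ k : Fin S, (f ω (x i) k - f ω (y j) k) ^ 2 ≤
                (1 + ε) * ‖x i - y j‖ ^ 2}).toReal := by
  rcases Nat.eq_zero_or_pos S with rfl | hSpos
  · have hT1 : T = 1 := by
      refine le_antisymm ((Real.log_nonpos_iff (by linarith)).1 ?_) hT
      norm_num at hS
      linarith
    subst hT1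
    exact le_trans (by norm_num) ENNReal.toReal_nonneg
  have hSpos' : (0 : ℝ) < S := by exact_mod_cast hSpos
  set u := x i - y j with hu
  have hnorm : 0 < ‖u‖ ^ 2 := pow_pos (norm_pos_iff.2 (sub_ne_zero.2 hxy)) 2
  have hv : (‖u‖ ^ 2).toNNReal ≠ 0 := (Real.toNNReal_pos.2 hnorm).ne'
  have hmp := (measurePreserving_gaussian_mulVec S u).comp
    (⟨hRm, hRdist⟩ : MeasurePreserving R ℙ _)
  have hsum (ω : Ω) : ∑ k, (f ω (x i) k - f ω (y j) k) ^ 2 =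
      (∑ k, (∑ l, R ω k l * u l) ^ 2) / S := by
    rw [Finset.sum_div]
    refine Finset.sum_congr rfl fun k _ => ?_
    rw [hf, hf, ← mul_sub, ← Finset.sum_sub_distrib, mul_pow, div_pow, Real.sq_sqrt hSpos'.le]
    simp_rw [hu, PiLp.sub_apply, mul_sub]
    ring
  have hset : {ω | (1 - ε) * ‖u‖ ^ 2 ≤ ∑ k : Fin S, (f ω (x i) k - f ω (y j) k) ^ 2 ∧
      ∑ k : Fin S, (f ω (x i) k - f ω (y j) k) ^ 2 ≤ (1 + ε) * ‖u‖ ^ 2} =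
      ((fun (r : Fin S → Fin n → ℝ) k => ∑ l, r k l * u l) ∘ R) ⁻¹'
        {z | Fintype.card (Fin S) * (1 - ε) * (‖u‖ ^ 2).toNNReal ≤ ∑ k, z k ^ 2 ∧
          ∑ k, z k ^ 2 ≤ Fintype.card (Fin S) * (1 + ε) * (‖u‖ ^ 2).toNNReal} := by
    ext ω
    simp only [Set.mem_ofPred_eq, Set.mem_preimage, Function.comp_apply, hsum, Fintype.card_fin,
      Real.coe_toNNReal _ hnorm.le, le_div_iff₀ hSpos', div_le_iff₀ hSpos']
    constructor <;> rintro ⟨h₁, h₂⟩ <;> constructor <;> linarith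
  rw [hset, hmp.measure_preimage (measurableSet_sum_sq_mem_Icc _ _).nullMeasurableSet]
  refine le_trans ?_ (one_sub_two_mul_exp_le_measureReal_sum_sq (ι := Fin S) hv hε₀.le hε₁)
  have hexp : Real.exp (-(Fintype.card (Fin S) / 2 * (ε ^ 2 / 2 - ε ^ 3 / 3))) ≤ 1 / T ^ 2 := by
    rw [one_div, ← Real.exp_log (show 0 < T ^ 2 by positivity), ← Real.exp_neg, Real.exp_le_exp,
      Real.log_pow, Fintype.card_fin]
    push_cast
    linarith
  calc 1 - 2 / T ^ 2 = 1 - 2 * (1 / T ^ 2) := by ring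
    _ ≤ _ := by gcongr
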